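/- Let q = p^s with p prime and s > 1, let 0 < i < s with m = gcd(i, s), and suppose p^m ≥ 3. Let h = (q − p^i)/2, or let p be odd and h = (p^i − 1)/2. Then the number of codewords of Hamming weight 4 in the BCH code C_h equals (p^m − 2)(q − 1)^2 q (q + 1) / 24. -/

import Mathlib

open Finset Matrix

/-- The matrix whose columns are the Segre vectors `(1, x, y, x * y)`. -/
def segreMatrix {K : Type*} [Field K] (x y : Fin 4 → K) : Matrix (Fin 4) (Fin 4) K :=
  Matrix.of fun r k => ![1, x k, y k, x k * y k] r

/-- The cross-ratio of four elements of a field. -/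
def fieldCrossRatio {K : Type*} [Field K] (x : Fin 4 → K) : K :=
  (x 2 - x 0) * (x 3 - x 1) / ((x 3 - x 0) * (x 2 - x 1))

theorem segreMatrix_mulVec_eq_zero_iff {K : Type*} [Field K] (x y b : Fin 4 → K) :
    segreMatrix x y *ᵥ b = 0 ↔ ∑ k, b k = 0 ∧ ∑ k, b k * x k = 0 ∧ ∑ k, b k * y k = 0 ∧
      ∑ k, b k * (x k * y k) = 0 := by
  simp [funext_iff, Fin.forall_fin_succ, segreMatrix, Matrix.mulVec, dotProduct, mul_comm]

theorem det_segreMatrix {K : Type*} [Field K] (x y : Fin 4 → K) :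
    (segreMatrix x y).det =
      (x 2 - x 0) * (y 2 - y 1) * ((x 3 - x 1) * (y 3 - y 0)) -
      (x 3 - x 0) * (y 3 - y 1) * ((x 2 - x 1) * (y 2 - y 0)) := by
  simp [segreMatrix, Matrix.det_succ_row_zero, Fin.sum_univ_succ, Fin.succAbove, Fin.ext_iff]
  ring

theorem eq_zero_of_segreMatrix_mulVec_eq_zero {K : Type*} [Field K] {x y b : Fin 4 → K}
    (hx : Function.Injective x) (hy : Function.Injective y)
    (hb : segreMatrix x y *ᵥ b = 0) {k : Fin 4} (hk : b k = 0) : b = 0 := by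
  obtain ⟨h1, h2, h3, h4⟩ := (segreMatrix_mulVec_eq_zero_iff x y b).1 hb
  have key (u v : K) : ∑ t, b t * ((x t - u) * (y t - v)) = 0 := by
    have : ∀ t, b t * ((x t - u) * (y t - v)) =
        b t * (x t * y t) - v * (b t * x t) - u * (b t * y t) + u * v * b t := fun t => by ring
    simp only [this, sum_add_distrib, sum_sub_distrib, ← mul_sum, h1, h2, h3, h4]
    ring
  funext l
  by_cases hl : l = k
  · rw [hl, hk]; rfl
  obtain ⟨i, j, hi, hj, hall⟩ : ∃ i j : Fin 4, l ≠ i ∧ l ≠ j ∧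
      ∀ t, t = k ∨ t = l ∨ t = i ∨ t = j := by
    clear * - hl
    revert k l
    decide
  have := key (x i) (y j)
  rw [sum_eq_single l] at this
  · simpa [sub_eq_zero, hx.eq_iff, hy.eq_iff, hi, hj] using this
  · intro t _ ht
    rcases hall t with rfl | rfl | rfl | rfl
    · simp [hk]
    · exact absurd rfl ht
    · simp
    · simp
  · simp

theorem det_segreMatrix_eq_zero_iff {K : Type*} [Field K] {x y : Fin 4 → K}
    (hx : Function.Injective x) (hy : Function.Injective y) :
    (segreMatrix x y).det = 0 ↔ fieldCrossRatio y = fieldCrossRatio x := by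
  have hx' {a b : Fin 4} (h : a ≠ b) : x a - x b ≠ 0 := sub_ne_zero.2 (hx.ne h)
  have hy' {a b : Fin 4} (h : a ≠ b) : y a - y b ≠ 0 := sub_ne_zero.2 (hy.ne h)
  have a1 : x 3 - x 0 ≠ 0 := hx' (by decide)
  have a2 : x 2 - x 1 ≠ 0 := hx' (by decide)
  have a3 : y 3 - y 0 ≠ 0 := hy' (by decide)
  have a4 : y 2 - y 1 ≠ 0 := hy' (by decide)
  rw [det_segreMatrix, fieldCrossRatio, fieldCrossRatio,
    div_eq_div_iff (mul_ne_zero a3 a4) (mul_ne_zero a1 a2), sub_eq_zero]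
  constructor <;> intro h <;> linear_combination -h

theorem exists_segre_weights {K : Type*} [Field K] {q Q h : ℕ}
    (hh : 2 * h + Q = q ∨ 2 * h + 1 = Q) {x : Fin 4 → K} (hx : ∀ k, x k ^ (q + 1) = 1) :
    ∃ w : Fin 4 → K, (∀ k, w k ≠ 0) ∧ ∀ a : Fin 4 → K,
      segreMatrix x (fun k => x k ^ Q) *ᵥ (fun k => a k * w k) = 0 ↔
      ((∑ k, a k * x k ^ h = 0 ∧ ∑ k, a k * x k ^ (h + 1) = 0) ∧
       ∑ k, a k * (x k)⁻¹ ^ h = 0 ∧ ∑ k, a k * (x k)⁻¹ ^ (h + 1) = 0) := by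
  have hx0 (k) : x k ≠ 0 := fun h0 => by simpa [h0] using hx k
  rcases hh with hh | hh
  · refine ⟨fun k => x k ^ h, fun k => pow_ne_zero _ (hx0 k), fun a => ?_⟩
    have e1 (k) : x k ^ h * x k ^ Q = (x k)⁻¹ ^ (h + 1) := by
      rw [inv_pow]
      refine eq_inv_of_mul_eq_one_left ?_
      rw [← hx k, ← hh]; ring
    have e2 (k) : x k ^ h * (x k * x k ^ Q) = (x k)⁻¹ ^ h := by
      rw [inv_pow]
      refine eq_inv_of_mul_eq_one_left ?_
      rw [← hx k, ← hh]; ring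
    rw [segreMatrix_mulVec_eq_zero_iff]
    simp only [mul_assoc, e1, e2, ← pow_succ]
    tauto
  · refine ⟨fun k => (x k)⁻¹ ^ (h + 1), fun k => pow_ne_zero _ (inv_ne_zero (hx0 k)),
      fun a => ?_⟩
    have e0 (k) : (x k)⁻¹ ^ (h + 1) * x k = (x k)⁻¹ ^ h := by
      rw [pow_succ, mul_assoc, inv_mul_cancel₀ (hx0 k), mul_one]
    have e1 (k) : (x k)⁻¹ ^ (h + 1) * x k ^ Q = x k ^ h := by
      rw [inv_pow, inv_mul_eq_iff_eq_mul₀ (pow_ne_zero _ (hx0 k)), ← hh]; ring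
    have e2 (k) : (x k)⁻¹ ^ (h + 1) * (x k * x k ^ Q) = x k ^ (h + 1) := by
      rw [inv_pow, inv_mul_eq_iff_eq_mul₀ (pow_ne_zero _ (hx0 k)), ← hh]; ring
    rw [segreMatrix_mulVec_eq_zero_iff]
    simp only [mul_assoc, e0, e1, e2]
    tauto

theorem FiniteField.exists_algebraMap_eq_of_pow_card_eq {F K : Type*} [Field F] [Field K]
    [Fintype F] [Algebra F K] {x : K} (hx : x ^ Fintype.card F = x) :
    ∃ a : F, algebraMap F K a = x := by
  classical
  have hne := FiniteField.X_pow_card_sub_X_ne_zero K (Fintype.one_lt_card (α := F))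
  have hsub : univ.image (algebraMap F K) ⊆
      (Polynomial.X ^ Fintype.card F - Polynomial.X : Polynomial K).roots.toFinset := by
    intro y hy
    obtain ⟨a, -, rfl⟩ := mem_image.1 hy
    simp [hne, ← map_pow, FiniteField.pow_card]
  have heq := eq_of_subset_of_card_le hsub <| by
    rw [card_image_of_injective _ (algebraMap F K).injective, card_univ]
    refine (Multiset.toFinset_card_le _).trans ((Polynomial.card_roots' _).trans ?_)
    rw [FiniteField.X_pow_card_sub_X_natDegree_eq K Fintype.one_lt_card]
  have : x ∈ univ.image (algebraMap F K) := by
    rw [heq]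
    simp [hne, hx]
  simpa using this

theorem card_crossRatio_values {K : Type*} [Field K] [Fintype K] [DecidableEq K] {p i s m : ℕ}
    (hp : p.Prime) (hm : m = Nat.gcd i s)
    (hK : Fintype.card K = (p ^ s) ^ 2) :
    #{l : K | l ≠ 0 ∧ l ≠ 1 ∧ l ^ p ^ i = l ∧ l ^ p ^ s = l} = p ^ m - 2 := by
  have hunit (u : Kˣ) (k : ℕ) : (u : K) ^ p ^ k = u ↔ u ^ (p ^ k - 1) = 1 := by
    obtain ⟨t, ht⟩ : ∃ t, p ^ k = t + 1 := ⟨p ^ k - 1, by have := Nat.pow_pos (n := k) hp.pos; omega⟩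
    rw [ht, Nat.add_sub_cancel, ← Units.val_pow_eq_pow_val, Units.val_inj, pow_succ,
      mul_eq_right]
  have hiff (u : Kˣ) : ((u : K) ^ p ^ i = u ∧ (u : K) ^ p ^ s = u) ↔ u ^ (p ^ m - 1) = 1 := by
    rw [hunit, hunit, hm, ← Nat.pow_sub_one_gcd_pow_sub_one, ← orderOf_dvd_iff_pow_eq_one,
      ← orderOf_dvd_iff_pow_eq_one, ← orderOf_dvd_iff_pow_eq_one, Nat.dvd_gcd_iff]
  have hcard : #{u : Kˣ | u ^ (p ^ m - 1) = 1} = p ^ m - 1 := by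
    have h1 := IsCyclic.card_powMonoidHom_ker (G := Kˣ) (p ^ m - 1)
    rw [Nat.card_eq_fintype_card (α := Kˣ), Fintype.card_units, hK, ← pow_mul,
      Nat.pow_sub_one_gcd_pow_sub_one, Nat.gcd_eq_right
        ((hm ▸ Nat.gcd_dvd_right i s).trans (dvd_mul_right s 2))] at h1
    refine Eq.trans ?_ h1
    rw [← Fintype.card_subtype, ← Nat.card_eq_fintype_card]
    rfl
  have herase : #(({u : Kˣ | u ^ (p ^ m - 1) = 1} : Finset Kˣ).erase 1) = p ^ m - 2 := by
    rw [card_erase_of_mem (by simp), hcard]; omega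
  rw [← herase, ← card_map ⟨((↑) : Kˣ → K), Units.val_injective⟩]
  congr 1
  ext l
  simp only [mem_filter, mem_univ, true_and, mem_map, mem_erase, Function.Embedding.coeFn_mk,
    ← hiff]
  constructor
  · rintro ⟨h0, h1, h2⟩
    exact ⟨Units.mk0 l h0, ⟨fun h => h1 (by simpa using congrArg Units.val h), h2⟩, rfl⟩
  · rintro ⟨u, ⟨h1, h2⟩, rfl⟩
    exact ⟨u.ne_zero, fun h => h1 (Units.ext h), h2⟩

theorem fieldCrossRatio_ne_zero {K : Type*} [Field K] {x : Fin 4 → K}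
    (hx : Function.Injective x) : fieldCrossRatio x ≠ 0 := by
  have hx' {a b : Fin 4} (h : a ≠ b) : x a - x b ≠ 0 := sub_ne_zero.2 (hx.ne h)
  exact div_ne_zero (mul_ne_zero (hx' (by decide)) (hx' (by decide)))
    (mul_ne_zero (hx' (by decide)) (hx' (by decide)))

theorem fieldCrossRatio_ne_one {K : Type*} [Field K] {x : Fin 4 → K}
    (hx : Function.Injective x) : fieldCrossRatio x ≠ 1 := by
  have hx' {a b : Fin 4} (h : a ≠ b) : x a - x b ≠ 0 := sub_ne_zero.2 (hx.ne h)
  rw [fieldCrossRatio, Ne, div_eq_one_iff_eq (mul_ne_zero (hx' (by decide)) (hx' (by decide)))]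
  intro h
  have : (x 1 - x 0) * (x 3 - x 2) = 0 := by linear_combination h
  exact mul_ne_zero (hx' (by decide)) (hx' (by decide)) this

theorem map_fieldCrossRatio {K : Type*} [Field K] (f : K →+* K) (x : Fin 4 → K) :
    f (fieldCrossRatio x) = fieldCrossRatio (fun k => f (x k)) := by
  simp [fieldCrossRatio]

theorem fieldCrossRatio_inv {K : Type*} [Field K] {x : Fin 4 → K}
    (hx : Function.Injective x) (hx0 : ∀ k, x k ≠ 0) :
    fieldCrossRatio (fun k => (x k)⁻¹) = fieldCrossRatio x := by
  have hx' {a b : Fin 4} (h : a ≠ b) : x a - x b ≠ 0 := sub_ne_zero.2 (hx.ne h)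
  have hi' {a b : Fin 4} (h : a ≠ b) : (x a)⁻¹ - (x b)⁻¹ ≠ 0 :=
    sub_ne_zero.2 fun e => hx.ne h (inv_injective e)
  have h0 := hx0 0
  have h1 := hx0 1
  have h2 := hx0 2
  have h3 := hx0 3
  rw [fieldCrossRatio, fieldCrossRatio, div_eq_div_iff
    (mul_ne_zero (hi' (by decide)) (hi' (by decide)))
    (mul_ne_zero (hx' (by decide)) (hx' (by decide)))]
  field_simp
  ring

theorem eq_of_fieldCrossRatio_eq {K : Type*} [Field K] {x y : Fin 4 → K}
    (hx : Function.Injective x) (hy : Function.Injective y)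
    (h0 : x 0 = y 0) (h1 : x 1 = y 1) (h2 : x 2 = y 2)
    (h : fieldCrossRatio x = fieldCrossRatio y) : x 3 = y 3 := by
  have hx' {a b : Fin 4} (h : a ≠ b) : x a - x b ≠ 0 := sub_ne_zero.2 (hx.ne h)
  have hy' {a b : Fin 4} (h : a ≠ b) : y a - y b ≠ 0 := sub_ne_zero.2 (hy.ne h)
  rw [fieldCrossRatio, fieldCrossRatio, div_eq_div_iff
    (mul_ne_zero (hx' (by decide)) (hx' (by decide)))
    (mul_ne_zero (hy' (by decide)) (hy' (by decide))), ← h0, ← h1, ← h2] at h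
  have key : ((x 2 - x 0) * (x 2 - x 1) * (x 1 - x 0)) * (x 3 - y 3) = 0 := by
    linear_combination h
  rcases mul_eq_zero.1 key with h | h
  · exact absurd h (mul_ne_zero (mul_ne_zero (hx' (by decide)) (hx' (by decide)))
      (hx' (by decide)))
  · exact sub_eq_zero.1 h

theorem exists_unit_circle_fieldCrossRatio_eq {K : Type*} [Field K] {q : ℕ} (σ : K →+* K)
    (hσ : ∀ z, σ z = z ^ q) {a b c l : K} (ha : a ^ (q + 1) = 1) (hb : b ^ (q + 1) = 1)
    (hc : c ^ (q + 1) = 1) (hab : a ≠ b) (hac : a ≠ c) (hbc : b ≠ c) (hl0 : l ≠ 0)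
    (hl1 : l ≠ 1) (hl : l ^ q = l) :
    ∃ d, d ^ (q + 1) = 1 ∧ Function.Injective ![a, b, c, d] ∧
      fieldCrossRatio ![a, b, c, d] = l := by
  have hne {z : K} (hz : z ^ (q + 1) = 1) : z ≠ 0 := fun h => by simp [h] at hz
  have hconj {z : K} (hz : z ^ (q + 1) = 1) : σ z = z⁻¹ := by
    rw [hσ]; exact eq_inv_of_mul_eq_one_left (by rw [← pow_succ, hz])
  have a0 := hne ha
  have b0 := hne hb
  have c0 := hne hc
  have hab' : b - a ≠ 0 := sub_ne_zero.2 hab.symm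
  have hac' : c - a ≠ 0 := sub_ne_zero.2 hac.symm
  have hbc' : c - b ≠ 0 := sub_ne_zero.2 hbc.symm
  obtain ⟨D, hD⟩ : ∃ D, D = (c - a) - l * (c - b) := ⟨_, rfl⟩
  obtain ⟨N, hN⟩ : ∃ N, N = b * (c - a) - l * a * (c - b) := ⟨_, rfl⟩
  have hσD : σ D = -N / (a * b * c) := by
    rw [hD, hN]
    simp only [map_sub, map_mul, hconj ha, hconj hb, hconj hc, hσ l, hl]
    field_simp
    ring
  have hD0 : D ≠ 0 := by
    intro h
    have hN0 : N = 0 := by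
      rw [h, map_zero] at hσD
      simpa [a0, b0, c0] using hσD.symm
    have : (b - a) * (c - a) = 0 := by linear_combination -hN + hN0 + a * hD - a * h
    exact mul_ne_zero hab' hac' this
  have hN0 : N ≠ 0 := by
    intro h
    rw [h, neg_zero, zero_div] at hσD
    exact hD0 (σ.injective (hσD.trans (map_zero σ).symm))
  have hσN : σ N = -D / (a * b * c) := by
    rw [hD, hN]
    simp only [map_sub, map_mul, hconj ha, hconj hb, hconj hc, hσ l, hl]
    field_simp
    ring
  have hda : N / D - a ≠ 0 := by
    rw [div_sub' hD0, div_ne_zero_iff]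
    refine ⟨fun h => mul_ne_zero hab' hac' ?_, hD0⟩
    rw [hN, hD] at h
    linear_combination h
  have hdb : N / D - b ≠ 0 := by
    rw [div_sub' hD0, div_ne_zero_iff]
    refine ⟨fun h => mul_ne_zero hl0 (mul_ne_zero hab' hbc') ?_, hD0⟩
    rw [hN, hD] at h
    linear_combination h
  have hdc : N / D - c ≠ 0 := by
    rw [div_sub' hD0, div_ne_zero_iff]
    refine ⟨fun h => mul_ne_zero (sub_ne_zero.2 hl1) (mul_ne_zero hac' hbc') ?_, hD0⟩
    rw [hN, hD] at h
    linear_combination h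
  refine ⟨N / D, ?_, ?_, ?_⟩
  · rw [pow_succ, ← hσ, map_div₀, hσN, hσD]
    field_simp
  · have h1 := sub_ne_zero.1 hda
    have h2 := sub_ne_zero.1 hdb
    have h3 := sub_ne_zero.1 hdc
    intro i j
    fin_cases i <;> fin_cases j <;>
      simp [hab, hab.symm, hac, hac.symm, hbc, hbc.symm, h1, h1.symm, h2, h2.symm, h3, h3.symm]
  · have : fieldCrossRatio ![a, b, c, N / D] = (c - a) * (N / D - b) / ((N / D - a) * (c - b)) :=
      rfl
    rw [this, div_eq_iff (mul_ne_zero hda hbc')]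
    field_simp
    rw [hN, hD]
    ring

theorem relation_iff_fieldCrossRatio {F K : Type*} [Field F] [Field K] [Fintype F] [Algebra F K]
    {p i q h : ℕ} [ExpChar K p] (hF : Fintype.card F = q)
    (hh : 2 * h + p ^ i = q ∨ 2 * h + 1 = p ^ i) {x : Fin 4 → K} (hinj : Function.Injective x)
    (hx : ∀ k, x k ^ (q + 1) = 1) :
    (∀ a : Fin 4 → F, a ≠ 0 → ∑ k, algebraMap F K (a k) * x k ^ h = 0 →
      ∑ k, algebraMap F K (a k) * x k ^ (h + 1) = 0 →
      (∀ k, a k ≠ 0) ∧ fieldCrossRatio x ^ p ^ i = fieldCrossRatio x) ∧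
    (fieldCrossRatio x ^ p ^ i = fieldCrossRatio x → ∃ a : Fin 4 → F, (∀ k, a k ≠ 0) ∧
      ∑ k, algebraMap F K (a k) * x k ^ h = 0 ∧
      ∑ k, algebraMap F K (a k) * x k ^ (h + 1) = 0) := by
  obtain ⟨w, hw, hiff⟩ := exists_segre_weights hh hx
  have hyinj : Function.Injective fun k => x k ^ p ^ i := by
    intro j k hjk
    exact hinj ((iterateFrobenius K p i).injective (by simpa [iterateFrobenius_def] using hjk))
  have hcr : fieldCrossRatio (fun k => x k ^ p ^ i) = fieldCrossRatio x ^ p ^ i := by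
    simpa [iterateFrobenius_def] using (map_fieldCrossRatio (iterateFrobenius K p i) x).symm
  have hdet := det_segreMatrix_eq_zero_iff hinj hyinj
  rw [hcr, ← Matrix.exists_mulVec_eq_zero_iff] at hdet
  set M := segreMatrix x (fun k => x k ^ p ^ i) with hM
  have hker {a : Fin 4 → K} (ha : M *ᵥ (fun k => a k * w k) = 0) {k : Fin 4} (hk : a k = 0) :
      a = 0 := by
    have := eq_zero_of_segreMatrix_mulVec_eq_zero hinj hyinj ha (k := k) (by simp [hk])
    funext j
    simpa [hw j] using congrFun this j
  set σ : K →+* K := (FiniteField.frobeniusAlgHom F K : K →+* K) with hσdef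
  have hσ (z : K) : σ z = z ^ q := by simp [hσdef, hF]
  have hσx (k) : σ (x k) = (x k)⁻¹ := by
    rw [hσ]; exact eq_inv_of_mul_eq_one_left (by rw [← pow_succ, hx])
  have hσF (a : F) : σ (algebraMap F K a) = algebraMap F K a := by
    simp [hσdef]
  have hconj {a : Fin 4 → K} {n : ℕ} (ha : ∑ k, a k * x k ^ n = 0) :
      ∑ k, σ (a k) * (x k)⁻¹ ^ n = 0 := by
    simpa [hσx] using congrArg σ ha
  have hconj' {a : Fin 4 → K} {n : ℕ} (ha : ∑ k, a k * (x k)⁻¹ ^ n = 0) :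
      ∑ k, σ (a k) * x k ^ n = 0 := by
    simpa [hσx] using congrArg σ ha
  constructor
  · intro a ha h1 h2
    have h3 := hconj h1
    have h4 := hconj h2
    simp only [hσF] at h3 h4
    have hMa := (hiff fun k => algebraMap F K (a k)).2 ⟨⟨h1, h2⟩, h3, h4⟩
    have hne : ∀ k, a k ≠ 0 := by
      intro k hk
      refine ha (funext fun j => ?_)
      simpa using congrFun (hker hMa (k := k) (by simp [hk])) j
    refine ⟨hne, hdet.1 ⟨_, fun h0 => hne 0 ?_, hMa⟩⟩
    simpa [hw 0] using congrFun h0 0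
  · intro hcross
    obtain ⟨v, hv, hMv⟩ := hdet.2 hcross
    have hvne (k) : v k ≠ 0 := fun hk =>
      hv (eq_zero_of_segreMatrix_mulVec_eq_zero hinj hyinj hMv hk)
    set a : Fin 4 → K := fun k => (v 0 / w 0)⁻¹ * (v k / w k) with hadef
    have ha0 : a 0 = 1 := inv_mul_cancel₀ (div_ne_zero (hvne 0) (hw 0))
    have hane (k) : a k ≠ 0 :=
      mul_ne_zero (inv_ne_zero (div_ne_zero (hvne 0) (hw 0))) (div_ne_zero (hvne k) (hw k))
    have hMa : M *ᵥ (fun k => a k * w k) = 0 := by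
      have : (fun k => a k * w k) = (v 0 / w 0)⁻¹ • v := by
        funext k
        simp only [hadef, Pi.smul_apply, smul_eq_mul, mul_assoc, div_mul_cancel₀ _ (hw k)]
      rw [this, Matrix.mulVec_smul, hMv, smul_zero]
    obtain ⟨⟨h1, h2⟩, h3, h4⟩ := (hiff a).1 hMa
    have hMσ := (hiff fun k => σ (a k)).2 ⟨⟨hconj' h3, hconj' h4⟩, hconj h1, hconj h2⟩
    have hsub : (fun k => σ (a k) - a k) = 0 := by
      refine hker (k := 0) ?_ (by simp [ha0])
      have : (fun k => (σ (a k) - a k) * w k) =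
          (fun k => σ (a k) * w k) - fun k => a k * w k := by
        funext k; simp [sub_mul]
      rw [this, Matrix.mulVec_sub, hMσ, hMa, sub_zero]
    have hfix (k) : a k ^ Fintype.card F = a k := by
      rw [hF, ← hσ]; exact sub_eq_zero.1 (congrFun hsub k)
    choose b hb using fun k => FiniteField.exists_algebraMap_eq_of_pow_card_eq (hfix k)
    refine ⟨b, fun k hk => hane k (by rw [← hb, hk, map_zero]), ?_, ?_⟩ <;> simpa only [hb]

/-- The number of ordered quadruples of points of the unit circle with cross-ratio in a given
subfield. -/
theorem card_quadruples {F K : Type*} [Field F] [Field K] [Fintype F] [Fintype K] [DecidableEq K]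
    [Algebra F K] {p i s q m : ℕ} (hp : p.Prime) (hq : q = p ^ s) (hm : m = Nat.gcd i s)
    (hF : Fintype.card F = q) (hK : Fintype.card K = q ^ 2) {β : K}
    (hβ : IsPrimitiveRoot β (q + 1)) :
    #{e : Fin 4 → Fin (q + 1) | Function.Injective e ∧
      fieldCrossRatio (fun k => β ^ (e k : ℕ)) ^ p ^ i =
        fieldCrossRatio (fun k => β ^ (e k : ℕ))} = (q + 1) * q * (q - 1) * (p ^ m - 2) := by
  classical
  set X : Fin (q + 1) → K := fun j => β ^ (j : ℕ) with hX
  have hXinj : Function.Injective X := fun j k hjk => Fin.ext (hβ.pow_inj j.2 k.2 hjk)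
  have hXU (j) : X j ^ (q + 1) = 1 := by
    rw [hX, ← pow_mul, mul_comm, pow_mul, hβ.pow_eq_one, one_pow]
  have hXsurj {z : K} (hz : z ^ (q + 1) = 1) : ∃ j, X j = z := by
    obtain ⟨j, hj, rfl⟩ := hβ.eq_pow_of_pow_eq_one hz
    exact ⟨⟨j, hj⟩, rfl⟩
  set σ : K →+* K := (FiniteField.frobeniusAlgHom F K : K →+* K) with hσdef
  have hσ (z : K) : σ z = z ^ q := by simp [hσdef, hF]
  have hX0 (j) : X j ≠ 0 := fun h => by simpa [h] using hXU j
  have hσX (j) : σ (X j) = (X j)⁻¹ := by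
    rw [hσ]; exact eq_inv_of_mul_eq_one_left (by rw [← pow_succ, hXU])
  have hreal {e : Fin 4 → Fin (q + 1)} (he : Function.Injective e) :
      fieldCrossRatio (fun k => X (e k)) ^ q = fieldCrossRatio (fun k => X (e k)) := by
    rw [← hσ, map_fieldCrossRatio]
    simp only [hσX]
    exact fieldCrossRatio_inv (hXinj.comp he) fun k => hX0 _
  set T : Finset (Fin 4 → Fin (q + 1)) := {e | Function.Injective e ∧
      fieldCrossRatio (fun k => X (e k)) ^ p ^ i = fieldCrossRatio (fun k => X (e k))} with hT
  set S : Finset (Fin 3 → Fin (q + 1)) := {t | Function.Injective t} with hS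
  have hScard : #S = (q + 1) * q * (q - 1) := by
    rw [hS, ← Fintype.card_subtype, Fintype.card_congr
      (Equiv.subtypeInjectiveEquivEmbedding (Fin 3) (Fin (q + 1))), Fintype.card_embedding_eq]
    simp [Nat.descFactorial]
    ring
  have hmaps : ∀ e ∈ T, Fin.init e ∈ S := by
    intro e he
    simp only [hT, hS, mem_filter, mem_univ, true_and] at he ⊢
    exact he.1.comp (Fin.castSucc_injective 3)
  rw [card_eq_sum_card_fiberwise hmaps, sum_const_nat (m := p ^ m - 2), hScard]
  intro t ht
  simp only [hS, mem_filter, mem_univ, true_and] at ht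
  rw [← card_crossRatio_values (i := i) hp hm (hq ▸ hK), ← hq]
  refine card_bij (fun e _ => fieldCrossRatio (fun k => X (e k))) ?_ ?_ ?_
  · intro e he
    simp only [hT, mem_filter, mem_univ, true_and] at he ⊢
    have hinj := hXinj.comp he.1.1
    exact ⟨fieldCrossRatio_ne_zero hinj, fieldCrossRatio_ne_one hinj, he.1.2, hreal he.1.1⟩
  · intro e he e' he' heq
    simp only [hT, mem_filter, mem_univ, true_and] at he he'
    have hinit : ∀ k : Fin 3, e k.castSucc = e' k.castSucc :=
      fun k => congrFun (he.2.trans he'.2.symm) k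
    have hlast := eq_of_fieldCrossRatio_eq (hXinj.comp he.1.1) (hXinj.comp he'.1.1)
      (congrArg X (hinit 0)) (congrArg X (hinit 1)) (congrArg X (hinit 2)) heq
    funext k
    refine Fin.lastCases ?_ hinit k
    exact hXinj hlast
  · intro l hl
    simp only [mem_filter, mem_univ, true_and] at hl
    obtain ⟨hl0, hl1, hlQ, hlq⟩ := hl
    obtain ⟨d, hd, hinj, hcross⟩ := exists_unit_circle_fieldCrossRatio_eq σ hσ (hXU (t 0))
      (hXU (t 1)) (hXU (t 2)) (hXinj.ne (ht.ne (by decide))) (hXinj.ne (ht.ne (by decide)))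
      (hXinj.ne (ht.ne (by decide))) hl0 hl1 hlq
    obtain ⟨j, rfl⟩ := hXsurj hd
    have hsnoc : (fun k => X ((Fin.snoc t j : Fin 4 → Fin (q + 1)) k)) =
        ![X (t 0), X (t 1), X (t 2), X j] := by
      funext k
      fin_cases k <;> rfl
    rw [← hsnoc] at hinj hcross
    refine ⟨Fin.snoc t j, ?_, hcross⟩
    simp only [hT, mem_filter, mem_univ, true_and]
    refine ⟨⟨fun a b hab => hinj (congrArg X hab), ?_⟩, Fin.init_snoc _ _⟩
    rw [hcross, hlQ]

theorem card_enumerations {α : Type*} [Fintype α] [DecidableEq α] {P : α → Prop}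
    [DecidablePred P] {n : ℕ} (hP : #{j | P j} = n) :
    #{e : Fin n → α | Function.Injective e ∧ ∀ j, P j ↔ j ∈ Set.range e} = n.factorial := by
  classical
  have hn : Fintype.card {j // P j} = n := by rw [Fintype.card_subtype, hP]
  have hcard : Fintype.card (Fin n ≃ {j // P j}) = n.factorial := by
    rw [Fintype.card_equiv (Fintype.equivFinOfCardEq hn).symm, Fintype.card_fin]
  rw [← hcard, ← card_univ, eq_comm]
  refine card_bij (fun f _ k => (f k : α)) ?_ ?_ ?_
  · intro f _
    simp only [mem_filter, mem_univ, true_and]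
    refine ⟨Subtype.val_injective.comp f.injective, fun j => ⟨fun hj => ?_, ?_⟩⟩
    · exact ⟨f.symm ⟨j, hj⟩, by simp⟩
    · rintro ⟨k, rfl⟩
      exact (f k).2
  · intro f _ g _ hfg
    ext k
    exact congrFun hfg k
  · intro e he
    simp only [mem_filter, mem_univ, true_and] at he
    refine ⟨Equiv.ofBijective (fun k => ⟨e k, (he.2 _).2 ⟨k, rfl⟩⟩) ⟨fun a b hab => ?_, ?_⟩,
      mem_univ _, rfl⟩
    · exact he.1 (congrArg Subtype.val hab)
    · rintro ⟨j, hj⟩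
      obtain ⟨k, rfl⟩ := (he.2 j).1 hj
      exact ⟨k, rfl⟩

theorem stmt10 (p s : ℕ) (hp : p.Prime) (hs : 1 < s) (q : ℕ) (hq : q = p ^ s)
    (i m : ℕ) (hi0 : 0 < i) (his : i < s) (hm : m = Nat.gcd i s) (hpm : 3 ≤ p ^ m)
    (h : ℕ) (hh : 2 * h = q - p ^ i ∨ (Odd p ∧ 2 * h = p ^ i - 1))
    (F K : Type) [Field F] [Field K] [Fintype F] [Fintype K] [DecidableEq F]
    [Algebra F K] (hF : Fintype.card F = q) (hK : Fintype.card K = q ^ 2)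
    (β : K) (hβ : IsPrimitiveRoot β (q + 1))
    (C : Set (Fin (q + 1) → F))
    (hC : C = {c | (∑ j : Fin (q + 1), algebraMap F K (c j) * β ^ (h * (j : ℕ)) = 0) ∧
      (∑ j : Fin (q + 1), algebraMap F K (c j) * β ^ ((h + 1) * (j : ℕ)) = 0)}) :
    24 * {c ∈ C | hammingNorm c = 4}.ncard =
      (p ^ m - 2) * (q - 1) ^ 2 * q * (q + 1) := by
  classical
  have hF' : Fact p.Prime := ⟨hp⟩
  have hcharK : CharP K p := charP_of_card_eq_prime_pow (f := s * 2) (by rw [hK, hq, pow_mul])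
  have hhp : 2 * h + p ^ i = q ∨ 2 * h + 1 = p ^ i := by
    have h1 : p ^ i ≤ q := hq ▸ Nat.pow_le_pow_right hp.pos his.le
    have h2 : 0 < p ^ i := Nat.pow_pos hp.pos
    omega
  set X : Fin (q + 1) → K := fun j => β ^ (j : ℕ) with hX
  have hXinj : Function.Injective X := fun j k hjk => Fin.ext (hβ.pow_inj j.2 k.2 hjk)
  have hXU (j) : X j ^ (q + 1) = 1 := by
    rw [hX, ← pow_mul, mul_comm, pow_mul, hβ.pow_eq_one, one_pow]
  have hrel {e : Fin 4 → Fin (q + 1)} (he : Function.Injective e) :=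
    relation_iff_fieldCrossRatio (F := F) hF hhp (hXinj.comp he) (fun k => hXU (e k))
  have hmem (c : Fin (q + 1) → F) : c ∈ C ↔ ∑ j, algebraMap F K (c j) * X j ^ h = 0 ∧
      ∑ j, algebraMap F K (c j) * X j ^ (h + 1) = 0 := by
    simp only [hC, Set.mem_ofPred_eq, hX, ← pow_mul, mul_comm]
  have hrestrict {c : Fin (q + 1) → F} {e : Fin 4 → Fin (q + 1)} (he : Function.Injective e)
      (hc : ∀ j, c j ≠ 0 → j ∈ Set.range e) (n : ℕ) :
      ∑ j, algebraMap F K (c j) * X j ^ n =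
        ∑ k, algebraMap F K (c (e k)) * (X ∘ e) k ^ n := by
    refine (Fintype.sum_of_injective e he _ _ (fun j hj => ?_) fun k => rfl).symm
    rw [not_not.1 (mt (hc j) hj), map_zero, zero_mul]
  set W : Finset (Fin (q + 1) → F) := {c | c ∈ C ∧ hammingNorm c = 4} with hW
  have hWcard : {c ∈ C | hammingNorm c = 4}.ncard = #W := by
    rw [← Set.ncard_coe_finset]
    congr 1
    ext c
    simp [hW]
  set T : Finset (Fin 4 → Fin (q + 1)) := {e | Function.Injective e ∧
      fieldCrossRatio (X ∘ e) ^ p ^ i = fieldCrossRatio (X ∘ e)} with hT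
  have hTcard : #T = (q + 1) * q * (q - 1) * (p ^ m - 2) := by
    rw [← card_quadruples hp hq hm hF hK hβ]
    simp only [hT, hX]
    congr
  have hcount : #W * 24 = #T * (q - 1) := by
    refine card_mul_eq_card_mul (fun c e => ∀ j, c j ≠ 0 ↔ j ∈ Set.range e) ?_ ?_
    · intro c hc
      simp only [hW, mem_filter, mem_univ, true_and] at hc
      rw [← show Nat.factorial 4 = 24 from rfl, ← card_enumerations hc.2, bipartiteAbove, hT,
        filter_filter]
      congr 1
      ext e
      simp only [mem_filter, mem_univ, true_and]
      refine ⟨fun ⟨he, hr⟩ => ⟨he.1, hr⟩, fun ⟨he, hr⟩ => ⟨⟨he, ?_⟩, hr⟩⟩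
      obtain ⟨h1, h2⟩ := (hmem c).1 hc.1
      rw [hrestrict he fun j => (hr j).1] at h1 h2
      refine ((hrel he).1 (fun k => c (e k)) (fun h0 => ?_) h1 h2).2
      exact (hr (e 0)).2 ⟨0, rfl⟩ (congrFun h0 0)
    · intro e he
      simp only [hT, mem_filter, mem_univ, true_and] at he
      obtain ⟨a, ha, ha1, ha2⟩ := (hrel he.1).2 he.2
      have hunits : #(univ.erase (0 : F)) = q - 1 := by
        rw [card_erase_of_mem (mem_univ _), card_univ, hF]
      rw [← hunits, bipartiteBelow]
      refine card_bij (fun c _ => c (e 0)) ?_ ?_ ?_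
      · intro c hc
        simp only [mem_filter, mem_erase, mem_univ, and_true] at hc ⊢
        exact (hc.2 _).2 ⟨0, rfl⟩
      · intro c hc c' hc' heq
        simp only [hW, mem_filter, mem_univ, true_and] at hc hc'
        obtain ⟨h1, h2⟩ := (hmem c).1 hc.1.1
        obtain ⟨h1', h2'⟩ := (hmem c').1 hc'.1.1
        rw [hrestrict he.1 fun j => (hc.2 j).1] at h1 h2
        rw [hrestrict he.1 fun j => (hc'.2 j).1] at h1' h2'
        have hsub : (fun k => c (e k) - c' (e k)) = 0 := by
          by_contra hne
          refine ((hrel he.1).1 _ hne ?_ ?_).1 0 (sub_eq_zero.2 heq)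
          · simp only [map_sub, sub_mul, sum_sub_distrib, h1, h1', sub_zero]
          · simp only [map_sub, sub_mul, sum_sub_distrib, h2, h2', sub_zero]
        funext j
        by_cases hj : j ∈ Set.range e
        · obtain ⟨k, rfl⟩ := hj
          exact sub_eq_zero.1 (congrFun hsub k)
        · rw [not_not.1 (mt (hc.2 j).1 hj), not_not.1 (mt (hc'.2 j).1 hj)]
      · intro z hz
        have hz0 : z ≠ 0 := (mem_erase.1 hz).1
        set c : Fin (q + 1) → F := Function.extend e (fun k => z * (a 0)⁻¹ * a k) 0 with hcdef
        have hce (k) : c (e k) = z * (a 0)⁻¹ * a k := he.1.extend_apply _ _ _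
        have hsupp (j) : c j ≠ 0 ↔ j ∈ Set.range e := by
          constructor
          · intro hj
            by_contra hj'
            exact hj (Function.extend_apply' _ _ _ hj')
          · rintro ⟨k, rfl⟩
            rw [hce]
            exact mul_ne_zero (mul_ne_zero hz0 (inv_ne_zero (ha 0))) (ha k)
        refine ⟨c, ?_, by rw [hce, mul_assoc, inv_mul_cancel₀ (ha 0), mul_one]⟩
        simp only [hW, mem_filter, mem_univ, true_and]
        refine ⟨⟨(hmem c).2 ⟨?_, ?_⟩, ?_⟩, hsupp⟩
        · rw [hrestrict he.1 fun j => (hsupp j).1]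
          simp only [hce, map_mul, mul_assoc, ← mul_sum, ha1, mul_zero]
        · rw [hrestrict he.1 fun j => (hsupp j).1]
          simp only [hce, map_mul, mul_assoc, ← mul_sum, ha2, mul_zero]
        · have : ({j | c j ≠ 0} : Finset (Fin (q + 1))) = univ.image e := by
            ext j
            simp [hsupp]
          rw [hammingNorm, this, card_image_of_injective _ he.1, card_univ, Fintype.card_fin]
  rw [hWcard, mul_comm, hcount, hTcard]
  ring
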